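/- Let (X,d) be a nonempty metric space which is geodesic, i.e., for any two points x,y ∈ X there exists a map γ from the real interval [0, d(x,y)] to X with γ(0) = x, γ(d(x,y)) = y and d(γ(s), γ(t)) = |s − t| for all s,t in the interval. Let μ be a Borel measure on X and let V, c be positive real numbers with μ(X) ≤ V, and suppose that for every x ∈ X the open metric ball B(x,1) satisfies μ(B(x,1)) ≥ c. Then the diameter of X is bounded: diam(X) ≤ 2·(V/c + 1) (in particular X is bounded, so the bound holds for the extended-real diameter). -/

import Mathlib

open MeasureTheory

/-- If every ball of radius `r` has mass at least `c`, then `n` points at pairwise distance at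
least `2 r` force the total mass to be at least `n * c`. -/
theorem natCast_mul_le_measure_univ_of_separated {X : Type*} [PseudoMetricSpace X]
    [MeasurableSpace X] [OpensMeasurableSpace X] {μ : Measure X} {c : ENNReal} {r : ℝ}
    (hball : ∀ x : X, c ≤ μ (Metric.ball x r)) {n : ℕ} (p : Fin n → X)
    (hp : Pairwise fun i j => 2 * r ≤ dist (p i) (p j)) :
    n * c ≤ μ Set.univ := by
  calc (n : ENNReal) * c = ∑ _i : Fin n, c := by simp
    _ ≤ ∑ i : Fin n, μ (Metric.ball (p i) r) := Finset.sum_le_sum fun i _ => hball (p i)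
    _ ≤ μ Set.univ := by
      refine sum_measure_le_measure_univ
        (fun i _ => Metric.isOpen_ball.measurableSet.nullMeasurableSet) fun i _ j _ hij => ?_
      refine (Metric.ball_disjoint_ball ?_).aedisjoint
      linarith [hp hij]

/-- If a nonempty geodesic metric space carries a Borel measure of total mass at most `V`
with every unit ball of mass at least `c > 0`, then its diameter is at most `2 (V/c + 1)`. -/
theorem finite_diameter_of_noncollapsed
    {X : Type*} [MetricSpace X] [Nonempty X] [MeasurableSpace X] [BorelSpace X]
    (μ : Measure X) (V c : ℝ) (hV : 0 < V) (hc : 0 < c)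
    (hgeo : ∀ x y : X, ∃ γ : ℝ → X, γ 0 = x ∧ γ (dist x y) = y ∧
      ∀ s ∈ Set.Icc (0 : ℝ) (dist x y), ∀ t ∈ Set.Icc (0 : ℝ) (dist x y),
        dist (γ s) (γ t) = |s - t|)
    (hμV : μ Set.univ ≤ ENNReal.ofReal V)
    (hball : ∀ x : X, ENNReal.ofReal c ≤ μ (Metric.ball x 1)) :
    EMetric.diam (Set.univ : Set X) ≤ ENNReal.ofReal (2 * (V / c + 1)) := by
  refine Metric.ediam_le_of_forall_dist_le fun x _ y _ => ?_
  obtain ⟨γ, -, -, hγ⟩ := hgeo x y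
  set n := ⌊dist x y / 2⌋₊ + 1 with hn
  have hmem (i : Fin n) : (2 * (i : ℕ) : ℝ) ∈ Set.Icc (0 : ℝ) (dist x y) := by
    have hi : ((i : ℕ) : ℝ) ≤ ⌊dist x y / 2⌋₊ := by
      exact_mod_cast Nat.lt_succ_iff.mp i.isLt
    have hfloor := Nat.floor_le (div_nonneg (dist_nonneg (x := x) (y := y)) zero_le_two)
    exact ⟨by positivity, by linarith⟩
  have hsep : Pairwise fun i j : Fin n =>
      2 * (1 : ℝ) ≤ dist (γ (2 * (i : ℕ))) (γ (2 * (j : ℕ))) := by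
    intro i j hij
    rw [hγ _ (hmem i) _ (hmem j), ← mul_sub, abs_mul, abs_two]
    have h : (1 : ℤ) ≤ |((i : ℕ) : ℤ) - (j : ℕ)| :=
      Int.one_le_abs (sub_ne_zero.mpr (by exact_mod_cast Fin.val_ne_of_ne hij))
    gcongr
    exact_mod_cast h
  have hmass : (n : ℝ) * c ≤ V := by
    have h := (natCast_mul_le_measure_univ_of_separated hball _ hsep).trans hμV
    rwa [← ENNReal.ofReal_natCast, ← ENNReal.ofReal_mul n.cast_nonneg,
      ENNReal.ofReal_le_ofReal_iff hV.le] at h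
  have hnV : (n : ℝ) ≤ V / c := (le_div_iff₀ hc).mpr hmass
  have hlt : dist x y / 2 < n := by
    rw [hn]
    exact_mod_cast Nat.lt_floor_add_one (dist x y / 2)
  linarith
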